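/- Let 0 < e_0 ≤ 1, m ≥ 1, and for each i ∈ Fin m let A_i : ℝ → ℝ satisfy A_i(0) = 0 and e_0·(t − s) ≤ A_i(t) − A_i(s) ≤ t − s for all 0 ≤ s ≤ t, with finish-time function g_i(w) = sInf {t ≥ 0 : A_i(t) ≥ w}. Let p : Fin n → ℝ with p_1 ≥ p_2 ≥ … ≥ p_n > 0 and let 1 ≤ d ≤ n. Let σ* be an assignment attaining the optimal makespan C* = min over assignments τ of max_i g_i(∑_{j : τ j = i} p_j). Suppose σ : Fin n → Fin m agrees with σ* on jobs 1, …, d and assigns jobs d+1, …, n in order by the ECT rule: for every job k > d and every machine i, g_{σ k}(L_{σ k}^{<k}(σ) + p_k) ≤ g_i(L_i^{<k}(σ) + p_k), where L_i^{<k}(σ) = ∑_{j < k, σ j = i} p_j. Then C_max(σ) = max_i g_i(∑_{j : σ j = i} p_j) ≤ (1 + m/(d·e_0))·C*. -/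

import Mathlib

noncomputable def finish (A : ℝ → ℝ) (w : ℝ) : ℝ := sInf {t : ℝ | 0 ≤ t ∧ w ≤ A t}

noncomputable def load {n m : ℕ} (p : Fin n → ℝ) (σ : Fin n → Fin m) (i : Fin m) : ℝ :=
  ∑ j ∈ Finset.univ.filter (fun j => σ j = i), p j

noncomputable def prefLoad {n m : ℕ} (p : Fin n → ℝ) (σ : Fin n → Fin m) (i : Fin m)
    (k : Fin n) : ℝ :=
  ∑ j ∈ Finset.univ.filter (fun j => j < k ∧ σ j = i), p j

noncomputable def makespan {n m : ℕ} (hm : 0 < m) (A : Fin m → ℝ → ℝ) (p : Fin n → ℝ)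
    (σ : Fin n → Fin m) : ℝ :=
  Finset.univ.sup' ⟨⟨0, hm⟩, Finset.mem_univ _⟩ (fun i => finish (A i) (load p σ i))

noncomputable def optMakespan {n m : ℕ} (hm : 0 < m) (A : Fin m → ℝ → ℝ) (p : Fin n → ℝ) : ℝ :=
  Finset.univ.inf' ⟨fun _ => ⟨0, hm⟩, Finset.mem_univ _⟩ (makespan hm A p)

/-- The finish time grows at rate at most `1 / e0` in the amount of work. -/
lemma finish_le_finish_add {e0 : ℝ} (he0 : 0 < e0) {A : ℝ → ℝ} (hA0 : A 0 = 0)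
    (hA : ∀ s t : ℝ, 0 ≤ s → s ≤ t → e0 * (t - s) ≤ A t - A s)
    {w w' x : ℝ} (hw : 0 ≤ w) (hx : 0 ≤ x) (h : w' ≤ w + x) :
    finish A w' ≤ finish A w + x / e0 := by
  have hmul (y : ℝ) : e0 * (y / e0) = y := mul_div_cancel₀ y he0.ne'
  have hne : {t : ℝ | 0 ≤ t ∧ w ≤ A t}.Nonempty := by
    have hw0 : 0 ≤ w / e0 := by positivity
    have := hA 0 (w / e0) le_rfl hw0
    rw [sub_zero, hmul, hA0] at this
    exact ⟨w / e0, hw0, by linarith⟩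
  rw [← sub_le_iff_le_add]
  refine le_csInf hne fun t ht => ?_
  rw [sub_le_iff_le_add]
  have hx0 : 0 ≤ x / e0 := by positivity
  have := hA t (t + x / e0) ht.1 (by linarith)
  rw [add_sub_cancel_left, hmul] at this
  exact csInf_le ⟨0, fun _ hy => hy.1⟩ ⟨by linarith [ht.1], by linarith [ht.2]⟩

lemma finish_mono {e0 : ℝ} (he0 : 0 < e0) {A : ℝ → ℝ} (hA0 : A 0 = 0)
    (hA : ∀ s t : ℝ, 0 ≤ s → s ≤ t → e0 * (t - s) ≤ A t - A s)
    {w w' : ℝ} (hw : 0 ≤ w) (h : w' ≤ w) : finish A w' ≤ finish A w := by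
  simpa using finish_le_finish_add he0 hA0 hA hw le_rfl (by simpa using h)

lemma le_finish {e0 : ℝ} (he0 : 0 < e0) {A : ℝ → ℝ} (hA0 : A 0 = 0)
    (hA : ∀ s t : ℝ, 0 ≤ s → s ≤ t → e0 * (t - s) ≤ A t - A s ∧ A t - A s ≤ t - s)
    {w : ℝ} (hw : 0 ≤ w) : w ≤ finish A w := by
  have hw0 : 0 ≤ w / e0 := by positivity
  refine le_csInf ⟨w / e0, hw0, ?_⟩ fun t ht => ?_
  · have := (hA 0 (w / e0) le_rfl hw0).1
    rw [sub_zero, mul_div_cancel₀ w he0.ne', hA0] at this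
    linarith
  · linarith [(hA 0 t le_rfl ht.1).2, ht.2]

lemma sum_load {n m : ℕ} (p : Fin n → ℝ) (σ : Fin n → Fin m) :
    ∑ i, load p σ i = ∑ j, p j :=
  Finset.sum_fiberwise _ σ p

lemma sum_prefLoad {n m : ℕ} (p : Fin n → ℝ) (σ : Fin n → Fin m) (k : Fin n) :
    ∑ i, prefLoad p σ i k = ∑ j ∈ Finset.univ.filter (fun j => j < k), p j := by
  simp only [prefLoad, ← Finset.filter_filter]
  exact Finset.sum_fiberwise _ σ p

lemma load_nonneg {n m : ℕ} {p : Fin n → ℝ} (hp : ∀ j, 0 < p j) (σ : Fin n → Fin m)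
    (i : Fin m) : 0 ≤ load p σ i :=
  Finset.sum_nonneg fun j _ => (hp j).le

/-- If no job after `k` runs on the machine of `k`, then `k` completes the load there. -/
lemma load_eq_prefLoad_add {n m : ℕ} (p : Fin n → ℝ) (σ : Fin n → Fin m) (k : Fin n)
    (hk : ∀ j, σ j = σ k → j ≤ k) : load p σ (σ k) = prefLoad p σ (σ k) k + p k := by
  have : Finset.univ.filter (fun j => σ j = σ k) =
      insert k (Finset.univ.filter (fun j => j < k ∧ σ j = σ k)) := by
    ext j
    have := hk j
    simp only [Finset.mem_filter, Finset.mem_univ, true_and, Finset.mem_insert]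
    grind
  rw [load, this, Finset.sum_insert (by simp), add_comm, prefLoad]

theorem stmt_11 (e0 : ℝ) (he0 : 0 < e0) (he0' : e0 ≤ 1)
    (m n : ℕ) (hm : 0 < m)
    (A : Fin m → ℝ → ℝ) (hA0 : ∀ i, A i 0 = 0)
    (hA : ∀ i, ∀ s t : ℝ, 0 ≤ s → s ≤ t →
      e0 * (t - s) ≤ A i t - A i s ∧ A i t - A i s ≤ t - s)
    (p : Fin n → ℝ) (hp : ∀ j, 0 < p j)
    (hLPT : ∀ j k : Fin n, j ≤ k → p k ≤ p j)
    (d : ℕ) (hd1 : 1 ≤ d) (hdn : d ≤ n)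
    (σstar : Fin n → Fin m) (hopt : makespan hm A p σstar = optMakespan hm A p)
    (σ : Fin n → Fin m)
    (hagree : ∀ k : Fin n, (k : ℕ) < d → σ k = σstar k)
    (hECT : ∀ k : Fin n, d ≤ (k : ℕ) → ∀ i : Fin m,
      finish (A (σ k)) (prefLoad p σ (σ k) k + p k) ≤ finish (A i) (prefLoad p σ i k + p k)) :
    makespan hm A p σ ≤ (1 + (m : ℝ) / ((d : ℝ) * e0)) * optMakespan hm A p := by
  have hlow (i : Fin m) (s t : ℝ) (hs : 0 ≤ s) (hst : s ≤ t) :=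
    (hA i s t hs hst).1
  rw [← hopt]
  set C := makespan hm A p σstar
  have hCi (i : Fin m) : finish (A i) (load p σstar i) ≤ C :=
    Finset.le_sup' (fun i => finish (A i) (load p σstar i)) (Finset.mem_univ i)
  have hloadC (i : Fin m) : load p σstar i ≤ C :=
    (le_finish he0 (hA0 i) (hA i) (load_nonneg hp σstar i)).trans (hCi i)
  have hC0 : 0 ≤ C := (load_nonneg hp σstar ⟨0, hm⟩).trans (hloadC _)
  have hd0 : (0 : ℝ) < d := by exact_mod_cast hd1
  refine Finset.sup'_le _ _ fun i _ => ?_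
  by_cases hlarge : ∀ j, σ j = i → (j : ℕ) < d
  · have hle : load p σ i ≤ load p σstar i := by
      refine Finset.sum_le_sum_of_subset_of_nonneg (fun j hj => ?_) fun j _ _ => (hp j).le
      simp only [Finset.mem_filter, Finset.mem_univ, true_and] at hj ⊢
      rw [← hagree j (hlarge j hj), hj]
    have h1 := finish_mono he0 (hA0 i) (hlow i) (load_nonneg hp σstar i) hle
    have h2 : 0 ≤ (m : ℝ) / (d * e0) * C := by positivity
    linarith [hCi i]
  push Not at hlarge
  obtain ⟨j₀, hj₀, hdj₀⟩ := hlarge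
  obtain ⟨k, hk, hmax⟩ := (Finset.univ.filter (fun j => σ j = i)).exists_max_image id
    ⟨j₀, by simpa using hj₀⟩
  simp only [Finset.mem_filter, Finset.mem_univ, true_and, id] at hk hmax
  subst hk
  have hdk : d ≤ (k : ℕ) := hdj₀.trans (hmax j₀ hj₀)
  rw [load_eq_prefLoad_add p σ k hmax]
  obtain ⟨i, -, hi⟩ : ∃ i ∈ Finset.univ, prefLoad p σ i k ≤ load p σstar i := by
    refine Finset.exists_le_of_sum_le ⟨⟨0, hm⟩, Finset.mem_univ _⟩ ?_
    rw [sum_prefLoad, sum_load]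
    exact Finset.sum_le_sum_of_subset_of_nonneg (Finset.subset_univ _) fun j _ _ => (hp j).le
  have hstep : finish (A i) (prefLoad p σ i k + p k) ≤
      finish (A i) (load p σstar i) + p k / e0 :=
    finish_le_finish_add he0 (hA0 i) (hlow i) (load_nonneg hp σstar i) (hp k).le (by linarith)
  have hcount : d * p k ≤ m * C := by
    calc (d : ℝ) * p k ≤ (k : ℕ) * p k := by
          have := (hp k).le
          gcongr
      _ = ∑ _j ∈ Finset.Iio k, p k := by simp
      _ ≤ ∑ j ∈ Finset.Iio k, p j :=
          Finset.sum_le_sum fun j hj => hLPT j k (Finset.mem_Iio.mp hj).le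
      _ ≤ ∑ j, p j :=
          Finset.sum_le_sum_of_subset_of_nonneg (Finset.subset_univ _) fun j _ _ => (hp j).le
      _ = ∑ i, load p σstar i := (sum_load p σstar).symm
      _ ≤ ∑ _i : Fin m, C := Finset.sum_le_sum fun i _ => hloadC i
      _ = m * C := by simp
  have hpk : p k / e0 ≤ (m : ℝ) / (d * e0) * C := by
    rw [div_mul_eq_mul_div, div_le_div_iff₀ he0 (by positivity)]
    nlinarith
  linarith [hECT k hdk i, hCi i]
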